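/- arXiv:2409.01599 — 4 statements merged into one kernel-verified Lean document; each statement's English description precedes it below -/
import Mathlib

section
/- Let G be a finite simple graph on n vertices, R a finite simple graph on r vertices, v a vertex of G, and let b satisfy r ≤ b ≤ n and r < n. Then the average of U_R(G[W]) over all b-element vertex subsets W containing v satisfies C(n−1, b−1)^{-1} · Σ_{W ∋ v, |W|=b} U_R(G[W]) = [(b−r)n / (b(n−r))] · U_R(G) + [r!(n−r−1)!(n−b) / (b(n−1)!)] · N_v(R,G), where U_R(H) = X_R(H)/C(|V(H)|, r). -/
open SimpleGraph Finset

/-- `XCount R G` is the number of copies of `R` in `G`, i.e. the number of subgraphs of `G`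
isomorphic to `R`. -/
noncomputable def XCount {α β : Type*} (R : SimpleGraph α) (G : SimpleGraph β) : ℕ :=
  Nat.card {S : G.Subgraph // Nonempty (S.coe ≃g R)}

/-- `NCount R G v` is the number of copies `S` of `R` in `G` with `v ∈ V(S)`. -/
noncomputable def NCount {α β : Type*} (R : SimpleGraph α) (G : SimpleGraph β) (v : β) : ℕ :=
  Nat.card {S : G.Subgraph // v ∈ S.verts ∧ Nonempty (S.coe ≃g R)}

/-- The network moment `U_R(G) = X_R(G) / C(|V(G)|, |V(R)|)`. -/
noncomputable def networkMoment {α β : Type*} [Fintype α] [Fintype β]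
    (R : SimpleGraph α) (G : SimpleGraph β) : ℝ :=
  (XCount R G : ℝ) / ((Fintype.card β).choose (Fintype.card α))

lemma XCount_induce {V α : Type*} (G : SimpleGraph V) (R : SimpleGraph α) (W : Set V) :
    XCount R (G.induce W) =
      Nat.card {S : G.Subgraph // S.verts ⊆ W ∧ Nonempty (S.coe ≃g R)} := by
  have hmc : ∀ S : G.Subgraph, S.verts ⊆ W →
      (S.comap (Copy.induce G W).toHom).map (Copy.induce G W).toHom = S := by
    intro S hS
    ext x y
    · simp only [Subgraph.map_verts, Subgraph.comap_verts, Set.mem_image, Set.mem_preimage]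
      constructor
      · rintro ⟨a, ha, rfl⟩; exact ha
      · intro hx; exact ⟨⟨x, hS hx⟩, hx, rfl⟩
    · simp only [Subgraph.map_adj, Relation.Map, Subgraph.comap_adj]
      constructor
      · rintro ⟨a, c, ⟨_, ha⟩, rfl, rfl⟩; exact ha
      · intro hx
        exact ⟨⟨x, hS (S.edge_vert hx)⟩, ⟨y, hS (S.edge_vert hx.symm)⟩,
          ⟨S.adj_sub hx, hx⟩, rfl, rfl⟩
  have hcm : ∀ S : (G.induce W).Subgraph,
      (S.map (Copy.induce G W).toHom).comap (Copy.induce G W).toHom = S := by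
    intro S
    ext x y
    · simp only [Subgraph.map_verts, Subgraph.comap_verts, Set.mem_preimage]
      exact (Copy.induce G W).injective.mem_set_image
    · simp only [Subgraph.map_adj, Relation.Map, Subgraph.comap_adj]
      constructor
      · rintro ⟨_, a, c, h, ha, hc⟩
        rw [← (Copy.induce G W).injective ha, ← (Copy.induce G W).injective hc]
        exact h
      · intro h
        exact ⟨S.adj_sub h, x, y, h, rfl, rfl⟩
  unfold XCount
  refine Nat.card_congr (Equiv.ofBijective (fun S => ⟨S.1.map (Copy.induce G W).toHom, ?_, ?_⟩)
    ⟨?_, ?_⟩)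
  · rintro _ ⟨a, _, rfl⟩; exact a.2
  · obtain ⟨e⟩ := S.2
    exact ⟨((Copy.induce G W).isoSubgraphMap S.1).symm.trans e⟩
  · intro S T h
    have h' : S.1.map (Copy.induce G W).toHom = T.1.map (Copy.induce G W).toHom :=
      congrArg Subtype.val h
    exact Subtype.ext (by rw [← hcm S.1, ← hcm T.1, h'])
  · rintro ⟨S, hS, ⟨e⟩⟩
    refine ⟨⟨S.comap (Copy.induce G W).toHom, ⟨?_⟩⟩, Subtype.ext (hmc S hS)⟩
    refine ((Copy.induce G W).isoSubgraphMap _).trans ?_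
    rw [hmc S hS]
    exact e

lemma count_sup {V : Type*} [Fintype V] [DecidableEq V] (T : Finset V) (b : ℕ) (hT : T.card ≤ b) :
    ((Finset.powersetCard b (Finset.univ : Finset V)).filter (T ⊆ ·)).card
      = (Fintype.card V - T.card).choose (b - T.card) := by
  rw [← Finset.card_compl, ← Finset.card_powersetCard]
  refine Finset.card_bij' (fun W _ => W \ T) (fun W _ => W ∪ T) ?_ ?_ ?_ ?_
  · intro W hW
    simp only [Finset.mem_filter, Finset.mem_powersetCard, Finset.subset_univ, true_and] at hW ⊢
    refine ⟨?_, ?_⟩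
    · intro x hx; simp at hx ⊢; exact hx.2
    · rw [Finset.card_sdiff_of_subset hW.2, hW.1]
  · intro W hW
    simp only [Finset.mem_filter, Finset.mem_powersetCard, Finset.subset_univ, true_and] at hW ⊢
    refine ⟨?_, Finset.subset_union_right⟩
    rw [Finset.card_union_of_disjoint, hW.2]
    · omega
    · exact Finset.disjoint_left.2 fun x hx => by simpa using hW.1 hx
  · intro W hW
    simp only [Finset.mem_filter] at hW
    exact Finset.sdiff_union_of_subset hW.2
  · intro W hW
    simp only [Finset.mem_powersetCard] at hW
    apply Finset.union_sdiff_cancel_right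
    exact Finset.disjoint_left.2 fun x hx => by simpa using hW.1 hx

lemma count_real {V : Type*} [Fintype V] [DecidableEq V] (T : Finset V) (v : V) (n r b : ℕ)
    (hn : Fintype.card V = n) (hT : T.card = r) (hrb : r ≤ b) (hb : 0 < b) (hbn : b ≤ n)
    (hrn : r < n) :
    (((Finset.powersetCard b (Finset.univ : Finset V)).filter
      (fun W => v ∈ W ∧ T ⊆ W)).card : ℝ)
      = (n - r).choose (b - r) / ((n : ℝ) - r) *
        (((b : ℝ) - r) + (if v ∈ T then (n : ℝ) - b else 0)) := by
  have hnr : (n : ℝ) - r ≠ 0 := by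
    have : (r : ℝ) < n := by exact_mod_cast hrn
    linarith
  have h0 : (Finset.powersetCard b (Finset.univ : Finset V)).filter (fun W => v ∈ W ∧ T ⊆ W)
      = (Finset.powersetCard b (Finset.univ : Finset V)).filter (insert v T ⊆ ·) := by
    ext W; simp [Finset.insert_subset_iff]
  rw [h0]
  split_ifs with hv
  · rw [Finset.insert_eq_of_mem hv, count_sup T b (by omega), hn, hT]
    field_simp
    ring
  · have hc := Finset.card_insert_of_notMem hv
    rcases hrb.eq_or_lt with h | h
    · subst h
      rw [Finset.card_eq_zero.2]
      · simp
      · rw [Finset.filter_eq_empty_iff]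
        intro W hW hs
        have := Finset.card_le_card hs
        rw [Finset.mem_powersetCard] at hW
        omega
    · rw [count_sup _ b (by omega), hc, hn, hT]
      obtain ⟨k, rfl⟩ : ∃ k, b = r + 1 + k := ⟨b - r - 1, by omega⟩
      obtain ⟨m, rfl⟩ : ∃ m, n = r + 1 + m := ⟨n - r - 1, by omega⟩
      have e1 : r + 1 + m - (r + 1) = m := by omega
      have e2 : r + 1 + k - (r + 1) = k := by omega
      have e3 : r + 1 + m - r = m + 1 := by omega
      have e4 : r + 1 + k - r = k + 1 := by omega
      rw [e1, e2, e3, e4]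
      have := Nat.add_one_mul_choose_eq m k
      have h2 : ((m : ℝ) + 1) * m.choose k = (m + 1).choose (k + 1) * (k + 1) := by
        exact_mod_cast this
      push_cast at hnr ⊢
      field_simp
      linarith

lemma sum_X {V α : Type*} [Fintype V] [DecidableEq V] [Fintype α]
    (G : SimpleGraph V) (R : SimpleGraph α) (n r b : ℕ)
    (hn : Fintype.card V = n) (hr : Fintype.card α = r) (v : V)
    (hrb : r ≤ b) (hb : 0 < b) (hbn : b ≤ n) (hrn : r < n) :
    ∑ W ∈ (Finset.powersetCard b (Finset.univ : Finset V)).filter (v ∈ ·),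
          (XCount R (G.induce (W : Set V)) : ℝ)
      = (n - r).choose (b - r) / ((n : ℝ) - r) *
        (((b : ℝ) - r) * XCount R G + ((n : ℝ) - b) * NCount R G v) := by
  classical
  have : Fintype G.Subgraph := Fintype.ofFinite _
  set C : Finset G.Subgraph := Finset.univ.filter (fun S => Nonempty (S.coe ≃g R)) with hC
  have hX : XCount R G = C.card := by
    unfold XCount
    rw [Nat.card_eq_fintype_card, Fintype.card_subtype]
  have hN : NCount R G v = (C.filter (fun S => v ∈ S.verts)).card := by
    unfold NCount
    rw [Nat.card_eq_fintype_card, Fintype.card_subtype, hC, Finset.filter_filter]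
    congr 1; ext S; simp [and_comm]
  have hW : ∀ W : Finset V, (XCount R (G.induce (W : Set V)) : ℝ)
      = ∑ S ∈ C, if S.verts.toFinset ⊆ W then (1 : ℝ) else 0 := by
    intro W
    rw [XCount_induce, Nat.card_eq_fintype_card, Fintype.card_subtype, Finset.sum_boole, hC,
      Finset.filter_filter]
    congr 2; ext S
    simp [and_comm, Set.subset_def, Finset.subset_iff]
  simp_rw [hW]
  rw [Finset.sum_comm]
  have key : ∀ S ∈ C, (∑ W ∈ (Finset.powersetCard b (Finset.univ : Finset V)).filter (v ∈ ·),
      if S.verts.toFinset ⊆ W then (1 : ℝ) else 0) = (n - r).choose (b - r) / ((n : ℝ) - r) *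
        (((b : ℝ) - r) + (if v ∈ S.verts then (n : ℝ) - b else 0)) := by
    intro S hS
    rw [Finset.sum_boole, Finset.filter_filter,
      count_real S.verts.toFinset v n r b hn ?_ hrb hb hbn hrn]
    · simp
    · obtain ⟨e⟩ := (Finset.mem_filter.1 hS).2
      rw [Set.toFinset_card, ← hr]
      exact Fintype.card_congr e.toEquiv
  rw [Finset.sum_congr rfl key, ← Finset.mul_sum, Finset.sum_add_distrib, ← Finset.sum_filter,
    Finset.sum_const, Finset.sum_const, hX, hN]
  simp only [nsmul_eq_mul]
  ring


/-- The average of `U_R(G[W])` over all `b`-element vertex subsets `W` containing `v`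
equals `[(b-r)n / (b(n-r))] · U_R(G) + [r!(n-r-1)!(n-b) / (b(n-1)!)] · N_v(R,G)`. -/
theorem stmt_8 {V α : Type*} [Fintype V] [DecidableEq V] [Fintype α]
    (G : SimpleGraph V) (R : SimpleGraph α) (n r b : ℕ)
    (hn : Fintype.card V = n) (hr : Fintype.card α = r) (v : V)
    (hrb : r ≤ b) (hbn : b ≤ n) (hrn : r < n) :
    ((n - 1).choose (b - 1) : ℝ)⁻¹ *
        ∑ W ∈ (Finset.powersetCard b (Finset.univ : Finset V)).filter (v ∈ ·),
          networkMoment R (G.induce ↑W)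
      = (((b : ℝ) - r) * n / ((b : ℝ) * ((n : ℝ) - r))) * networkMoment R G
        + ((Nat.factorial r : ℝ) * (Nat.factorial (n - r - 1)) * ((n : ℝ) - b)
            / ((b : ℝ) * (Nat.factorial (n - 1)))) * NCount R G v := by
  rcases Nat.eq_zero_or_pos b with hb | hb
  · subst hb
    have : (Finset.powersetCard 0 (Finset.univ : Finset V)).filter (v ∈ ·) = ∅ := by
      ext W; simp; rintro rfl; simp
    rw [this]; simp
  have hs := sum_X G R n r b hn hr v hrb hb hbn hrn
  have hm : ∀ W ∈ (Finset.powersetCard b (Finset.univ : Finset V)).filter (v ∈ ·),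
      networkMoment R (G.induce (W : Set V))
        = (XCount R (G.induce (W : Set V)) : ℝ) / (b.choose r : ℕ) := by
    intro W hW
    have hWc : W.card = b := (Finset.mem_powersetCard.1 (Finset.mem_filter.1 hW).1).2
    unfold networkMoment
    have hc : Fintype.card (W : Set V) = b := by simpa using hWc
    rw [hr]
    congr 3
  rw [Finset.sum_congr rfl hm, ← Finset.sum_div, hs]
  unfold networkMoment
  rw [hn, hr]
  generalize (XCount R G : ℝ) = X
  generalize (NCount R G v : ℝ) = N
  have hnr : (n : ℝ) - r ≠ 0 := by
    have : (r : ℝ) < n := by exact_mod_cast hrn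
    linarith
  have hb' : (b : ℝ) ≠ 0 := by positivity
  have hn' : (n : ℝ) ≠ 0 := by
    have : 0 < n := by omega
    positivity
  have c1 : ((n - 1).choose (b - 1) : ℝ) ≠ 0 := by
    exact_mod_cast (Nat.choose_pos (by omega : b - 1 ≤ n - 1)).ne'
  have c2 : (b.choose r : ℝ) ≠ 0 := by exact_mod_cast (Nat.choose_pos hrb).ne'
  have c3 : (n.choose r : ℝ) ≠ 0 := by exact_mod_cast (Nat.choose_pos hrn.le).ne'
  have e1 : (n : ℝ) * (n - 1).choose (b - 1) = n.choose b * b := by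
    obtain ⟨k, rfl⟩ : ∃ k, b = k + 1 := ⟨b - 1, by omega⟩
    obtain ⟨m, rfl⟩ : ∃ m, n = m + 1 := ⟨n - 1, by omega⟩
    exact_mod_cast Nat.add_one_mul_choose_eq m k
  have e2 : (n.choose b : ℝ) * b.choose r = n.choose r * (n - r).choose (b - r) := by
    exact_mod_cast Nat.choose_mul (n := n) hrb
  have e3 : (n.choose r : ℝ) * r.factorial * ((n - r) * (n - r - 1).factorial)
      = n * (n - 1).factorial := by
    have h1 := Nat.choose_mul_factorial_mul_factorial hrn.le
    rw [← Nat.mul_factorial_pred (by omega : n - r ≠ 0),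
      ← Nat.mul_factorial_pred (by omega : n ≠ 0)] at h1
    rw [← Nat.cast_sub hrn.le]
    exact_mod_cast h1
  have f1 : ((n - r).choose (b - r) : ℝ) / ((n - 1).choose (b - 1) * b.choose r)
      = n / (b * n.choose r) := by
    rw [div_eq_div_iff (by positivity) (by positivity)]
    linear_combination (-(b : ℝ)) * e2 - (b.choose r : ℝ) * e1
  have f2 : (r.factorial : ℝ) * (n - r - 1).factorial / (n - 1).factorial
      = n / (n.choose r * (n - r)) := by
    have : ((n - 1).factorial : ℝ) ≠ 0 := by positivity
    rw [div_eq_div_iff this (mul_ne_zero c3 hnr)]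
    linear_combination e3
  calc _ = ((n - r).choose (b - r) : ℝ) / ((n - 1).choose (b - 1) * b.choose r)
        * (((b : ℝ) - r) * X + ((n : ℝ) - b) * N) / (n - r) := by
        field_simp
    _ = ((b : ℝ) - r) * n / ((b : ℝ) * ((n : ℝ) - r)) * (X / n.choose r)
        + (n / (n.choose r * (n - r))) * (((n : ℝ) - b) / b) * N := by
        rw [f1]; field_simp
    _ = _ := by rw [← f2]; field_simp
end

section
/- Let G be a finite simple graph on n vertices, let R and R' be finite simple graphs on r and r' vertices respectively, and let b satisfy max(r, r') ≤ b ≤ n. Then Σ_{W ⊆ V(G), |W|=b} X_R(G[W]) · X_{R'}(G[W]) = Σ_{(S_1, S_2)} C(n − |V(S_1) ∪ V(S_2)|, b − |V(S_1) ∪ V(S_2)|), where the right-hand sum is over all ordered pairs (S_1, S_2) with S_1 a copy of R in G and S_2 a copy of R' in G (with the convention C(m,k) = 0 when k < 0 or k > m), and G[W] denotes the induced subgraph of G on W. -/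
open SimpleGraph Finset

lemma aux_count {V : Type*} [Fintype V] [DecidableEq V] (U : Finset V) (b : ℕ) :
    #{W ∈ powersetCard b (univ : Finset V) | U ⊆ W}
      = if #U ≤ b then (Fintype.card V - #U).choose (b - #U) else 0 := by
  split_ifs with h
  · rw [← card_compl, ← card_powersetCard]
    refine card_bij' (fun W _ => W \ U) (fun T _ => T ∪ U) ?_ ?_ ?_ ?_
    · intro W hW
      simp only [mem_filter, mem_powersetCard, subset_univ, true_and] at hW ⊢
      refine ⟨fun x hx => by simp at hx ⊢; exact hx.2, ?_⟩
      rw [card_sdiff_of_subset hW.2, hW.1]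
    · intro T hT
      simp only [mem_filter, mem_powersetCard, subset_univ, true_and] at hT ⊢
      refine ⟨?_, subset_union_right⟩
      rw [card_union_of_disjoint, hT.2]
      · omega
      · exact (subset_compl_iff_disjoint_right.1 hT.1)
    · intro W hW
      simp only [mem_filter] at hW
      exact sdiff_union_of_subset hW.2
    · intro T hT
      simp only [mem_powersetCard] at hT
      exact union_sdiff_cancel_right (subset_compl_iff_disjoint_right.1 hT.1)
  · rw [card_eq_zero, filter_eq_empty_iff]
    intro W hW hUW
    have := card_le_card hUW
    rw [mem_powersetCard] at hW
    omega

/-- Copies inside an induced subgraph as copies in the big graph. -/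
noncomputable def auxIso {V : Type*} {G : SimpleGraph V} {W : Set V}
    (S : (G.induce W).Subgraph) :
    S.coe ≃g (S.map (Embedding.induce W).toHom).coe where
  toEquiv := Equiv.Set.image _ S.verts (Embedding.induce (G := G) W).injective
  map_rel_iff' := by
    rintro ⟨a, ha⟩ ⟨b, hb⟩
    simp only [Subgraph.coe_adj, Subgraph.map_adj, Relation.Map]
    constructor
    · rintro ⟨c, d, h, hc, hd⟩
      have hc := Subtype.ext hc
      have hd := Subtype.ext hd
      subst hc hd
      exact h
    · intro h
      exact ⟨a, b, h, rfl, rfl⟩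

lemma aux_map_comap {V : Type*} {G : SimpleGraph V} {W : Set V} (S : G.Subgraph)
    (h : S.verts ⊆ W) :
    (S.comap (Embedding.induce (G := G) W).toHom).map (Embedding.induce W).toHom = S := by
  ext a b
  · simp only [Subgraph.map_verts, Subgraph.comap_verts]
    constructor
    · rintro ⟨x, hx, rfl⟩
      exact hx
    · intro ha
      exact ⟨⟨a, h ha⟩, ha, rfl⟩
  · simp only [Subgraph.map_adj, Subgraph.comap_adj, Relation.Map]
    constructor
    · rintro ⟨x, y, hx, rfl, rfl⟩
      exact hx.2
    · intro hab
      exact ⟨⟨a, h hab.fst_mem⟩, ⟨b, h hab.snd_mem⟩, ⟨hab.adj_sub, hab⟩, rfl, rfl⟩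

lemma aux_comap_map {V : Type*} {G : SimpleGraph V} {W : Set V} (S : (G.induce W).Subgraph) :
    (S.map (Embedding.induce (G := G) W).toHom).comap (Embedding.induce W).toHom = S := by
  ext a b
  · simp only [Subgraph.map_verts, Subgraph.comap_verts]
    constructor
    · rintro ⟨x, hx, h⟩
      have h := Subtype.ext h
      subst h
      exact hx
    · intro ha
      exact ⟨a, ha, rfl⟩
  · simp only [Subgraph.map_adj, Subgraph.comap_adj, Relation.Map]
    constructor
    · rintro ⟨_, x, y, h, hx, hy⟩
      have hx := Subtype.ext hx
      have hy := Subtype.ext hy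
      subst hx hy
      exact h
    · intro hab
      exact ⟨hab.adj_sub, a, b, hab, rfl, rfl⟩

lemma aux_X {V α : Type*} (G : SimpleGraph V) (R : SimpleGraph α) (W : Set V) :
    XCount R (G.induce W) =
      Nat.card {S : {S : G.Subgraph // Nonempty (S.coe ≃g R)} // S.1.verts ⊆ W} := by
  refine Nat.card_congr (Equiv.ofBijective (fun S => ⟨⟨S.1.map (Embedding.induce W).toHom,
    S.2.map fun e => (auxIso S.1).symm.trans e⟩, ?_⟩) ⟨?_, ?_⟩)
  · rintro _ ⟨x, _, rfl⟩
    exact x.2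
  · intro S T h
    have h : S.1.map (Embedding.induce W).toHom = T.1.map (Embedding.induce W).toHom :=
      congrArg (fun x => x.1.1) h
    have h' := congrArg (Subgraph.comap (Embedding.induce (G := G) W).toHom) h
    rw [aux_comap_map, aux_comap_map] at h'
    exact Subtype.ext h'
  · rintro ⟨⟨S, hS⟩, hW⟩
    have key := aux_map_comap S hW
    refine ⟨⟨S.comap (Embedding.induce (G := G) W).toHom, ?_⟩, ?_⟩
    · have e := auxIso (S.comap (Embedding.induce (G := G) W).toHom)
      rw [key] at e
      exact hS.map fun f => e.trans f
    · exact Subtype.ext (Subtype.ext key)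

open scoped Classical in
lemma aux_Y {V α : Type*} (G : SimpleGraph V) (R : SimpleGraph α) (W : Set V)
    [Fintype {S : G.Subgraph // Nonempty (S.coe ≃g R)}] :
    XCount R (G.induce W) =
      ∑ S : {S : G.Subgraph // Nonempty (S.coe ≃g R)}, if S.1.verts ⊆ W then 1 else 0 := by
  rw [aux_X, Nat.card_eq_fintype_card, Fintype.card_subtype, card_filter]

/-- `Σ_{|W|=b} X_R(G[W])·X_{R'}(G[W])` equals the sum over all ordered pairs `(S₁, S₂)` of a
copy of `R` and a copy of `R'` in `G` of `C(n − |V(S₁) ∪ V(S₂)|, b − |V(S₁) ∪ V(S₂)|)`, with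
the convention that the binomial coefficient is `0` when `b − |V(S₁) ∪ V(S₂)| < 0`. -/
theorem stmt_13 {V α β : Type*} [Fintype V] [DecidableEq V] [Fintype α] [Fintype β]
    (G : SimpleGraph V) (R : SimpleGraph α) (R' : SimpleGraph β) (n r r' b : ℕ)
    (hn : Fintype.card V = n) (hr : Fintype.card α = r) (hr' : Fintype.card β = r')
    (hrb : max r r' ≤ b) (hbn : b ≤ n) :
    ∑ W ∈ Finset.powersetCard b (Finset.univ : Finset V),
        XCount R (G.induce ↑W) * XCount R' (G.induce ↑W)
      = ∑ᶠ (S₁ : {S : G.Subgraph // Nonempty (S.coe ≃g R)})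
          (S₂ : {S : G.Subgraph // Nonempty (S.coe ≃g R')}),
          if Nat.card ↥(S₁.1.verts ∪ S₂.1.verts) ≤ b then
            (n - Nat.card ↥(S₁.1.verts ∪ S₂.1.verts)).choose
              (b - Nat.card ↥(S₁.1.verts ∪ S₂.1.verts))
          else 0 := by
  classical
  have : Fintype {S : G.Subgraph // Nonempty (S.coe ≃g R)} := Fintype.ofFinite _
  have : Fintype {S : G.Subgraph // Nonempty (S.coe ≃g R')} := Fintype.ofFinite _
  simp only [finsum_eq_sum_of_fintype, aux_Y, sum_mul_sum]
  rw [sum_comm]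
  refine sum_congr rfl fun S₁ _ => ?_
  rw [sum_comm]
  refine sum_congr rfl fun S₂ _ => ?_
  have h := aux_count (S₁.1.verts ∪ S₂.1.verts).toFinset b
  have hc : Nat.card ↥(S₁.1.verts ∪ S₂.1.verts) = #(S₁.1.verts ∪ S₂.1.verts).toFinset := by
    rw [Nat.card_eq_fintype_card, Set.toFinset_card]
  rw [hc, ← hn, ← h, card_filter]
  refine sum_congr rfl fun W _ => ?_
  have hiff : (S₁.1.verts ∪ S₂.1.verts).toFinset ⊆ W ↔
      S₁.1.verts ⊆ (W : Set V) ∧ S₂.1.verts ⊆ (W : Set V) := by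
    rw [Set.toFinset_subset, Set.union_subset_iff]
  by_cases h1 : S₁.1.verts ⊆ (W : Set V) <;> by_cases h2 : S₂.1.verts ⊆ (W : Set V) <;>
    simp only [hiff, h1, h2, if_true, if_false, and_self, and_true, and_false, mul_one, mul_zero]
end

section
/- Fix positive integers r and r' and set s = r + r'. Let (b_n) be a sequence of natural numbers with b_n ≤ n, b_n → ∞, and b_n/n → c₂ for some c₂ ∈ [0,1). Then, as n → ∞, [(b_n−r)!·(b_n−r')!·n!·(n−s)! − b_n!·(b_n−s)!·(n−r)!·(n−r')!] / [(b_n−1)!·(b_n−s)!·n!·(n−s)!] converges to −r·r'·(1−c₂). -/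
open Filter

noncomputable def gq (q k m : ℕ) : ℝ :=
  ((m - k).factorial : ℝ) * ((m - q).factorial : ℝ) / ((m.factorial : ℝ) * ((m - (k + q)).factorial : ℝ))

lemma gq_zero (q m : ℕ) : gq q 0 m = 1 := by
  unfold gq
  have h1 := Nat.factorial_ne_zero m
  have h2 := Nat.factorial_ne_zero (m - q)
  simp only [Nat.sub_zero, Nat.zero_add]
  field_simp

lemma gq_succ (q k m : ℕ) (h : k + 1 + q ≤ m) :
    gq q (k + 1) m = gq q k m * (1 - (q : ℝ) / ((m : ℝ) - k)) := by
  obtain ⟨t, rfl⟩ := Nat.exists_eq_add_of_le h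
  unfold gq
  have e1 : k + 1 + q + t - (k + 1) = q + t := by omega
  have e2 : k + 1 + q + t - k = (q + t) + 1 := by omega
  have e3 : k + 1 + q + t - (k + 1 + q) = t := by omega
  have e4 : k + 1 + q + t - (k + q) = t + 1 := by omega
  rw [e1, e2, e3, e4, Nat.factorial_succ (q + t), Nat.factorial_succ t]
  have h1 := Nat.factorial_ne_zero (k + 1 + q + t)
  have h2 := Nat.factorial_ne_zero t
  have e5 : ((k + 1 + q + t : ℕ) : ℝ) - k = (q : ℝ) + t + 1 := by push_cast; ring
  rw [e5]
  have h3 : (q : ℝ) + t + 1 ≠ 0 := by positivity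
  have h4 : (t : ℝ) + 1 ≠ 0 := by positivity
  push_cast
  field_simp
  ring

lemma gq_lim (q k : ℕ) : Tendsto (gq q k) atTop (nhds 1) ∧
    Tendsto (fun m : ℕ => (m : ℝ) * (1 - gq q k m)) atTop (nhds ((k : ℝ) * q)) := by
  induction k with
  | zero => 
    have : gq q 0 = fun _ => (1 : ℝ) := funext (gq_zero q)
    simp [this]
  | succ k ih =>
    obtain ⟨i1, i2⟩ := ih
    have hinf : Tendsto (fun m : ℕ => (m : ℝ) - k) atTop atTop :=
      tendsto_atTop_add_const_right _ (-(k : ℝ)) tendsto_natCast_atTop_atTop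
    have hq : ∀ c : ℝ, Tendsto (fun m : ℕ => c / ((m : ℝ) - k)) atTop (nhds 0) :=
      fun c => hinf.const_div_atTop c
    constructor
    · have := i1.mul ((tendsto_const_nhds (x := (1 : ℝ))).sub (hq q))
      rw [sub_zero, mul_one] at this
      refine this.congr' ?_
      filter_upwards [eventually_ge_atTop (k + 1 + q)] with m hm
      exact (gq_succ q k m hm).symm
    · have := i2.add ((i1.mul_const (q : ℝ)).mul
        ((tendsto_const_nhds (x := (1 : ℝ))).add (hq k)))
      have e : ((k + 1 : ℕ) : ℝ) * q = k * q + 1 * q * (1 + 0) := by push_cast; ring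
      rw [e]
      refine this.congr' ?_
      filter_upwards [eventually_ge_atTop (k + 1 + q)] with m hm
      rw [gq_succ q k m hm]
      have : (m : ℝ) - k ≠ 0 := by
        have : (k : ℝ) + 1 + q ≤ m := by exact_mod_cast hm
        have : (0 : ℝ) ≤ q := by positivity
        apply ne_of_gt; linarith
      field_simp
      ring

/-- For fixed positive integers `r, r'` with `s = r + r'`, and a sequence `b_n <= n` with
`b_n -> oo` and `b_n/n -> c2` in `[0,1)`, the ratio
`[(b_n-r)!(b_n-r')!n!(n-s)! - b_n!(b_n-s)!(n-r)!(n-r')!] / [(b_n-1)!(b_n-s)!n!(n-s)!]`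
converges to `-r*r'*(1-c2)`. -/
theorem stmt_16 (r r' : ℕ) (hr : 0 < r) (hr' : 0 < r') (b : ℕ → ℕ) (c₂ : ℝ)
    (hbn : ∀ n, b n ≤ n) (hbtop : Tendsto b atTop atTop)
    (hc : Tendsto (fun n : ℕ => (b n : ℝ) / (n : ℝ)) atTop (nhds c₂))
    (hc0 : 0 ≤ c₂) (hc1 : c₂ < 1) :
    Tendsto (fun n : ℕ =>
        (((b n - r).factorial : ℝ) * ((b n - r').factorial : ℝ) * (n.factorial : ℝ)
            * ((n - (r + r')).factorial : ℝ)
          - ((b n).factorial : ℝ) * ((b n - (r + r')).factorial : ℝ)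
            * ((n - r).factorial : ℝ) * ((n - r').factorial : ℝ))
        / (((b n - 1).factorial : ℝ) * ((b n - (r + r')).factorial : ℝ) * (n.factorial : ℝ)
            * ((n - (r + r')).factorial : ℝ)))
      atTop (nhds (-(r : ℝ) * (r' : ℝ) * (1 - c₂))) := by
  have H := (gq_lim r' r).2
  have A := (hc.mul H).sub (H.comp hbtop)
  have e : -(r : ℝ) * (r' : ℝ) * (1 - c₂) = c₂ * (r * r') - r * r' := by ring
  rw [e]
  refine A.congr' ?_
  filter_upwards [hbtop.eventually_ge_atTop 1, eventually_ge_atTop 1] with n hb hn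
  have hn0 : (n : ℝ) ≠ 0 := by positivity
  simp only [Function.comp]
  unfold gq
  generalize b n = B at *
  obtain ⟨B, rfl⟩ := Nat.exists_eq_add_of_le' hb
  rw [Nat.add_sub_cancel, Nat.factorial_succ B]
  have h1 := Nat.factorial_ne_zero B
  have h2 := Nat.factorial_ne_zero (B + 1 - (r + r'))
  have h3 := Nat.factorial_ne_zero n
  have h4 := Nat.factorial_ne_zero (n - (r + r'))
  have h5 : (B : ℝ) + 1 ≠ 0 := by positivity
  push_cast
  field_simp
  ring
end

section
/- Fix positive integers r and r' and set s = r + r' − 1. Let (b_n) be a sequence of natural numbers with b_n ≤ n, b_n → ∞, and b_n/n → c₂ for some c₂ ∈ [0,1). Then, as n → ∞, [(b_n−r)!·(b_n−r')!·n!·(n−s)! − b_n!·(b_n−s)!·(n−r)!·(n−r')!] / [(b_n−1)!·(b_n−s)!·n!·(n−s)!] converges to 1 − c₂. -/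
open Filter

theorem aux_ratio (l : ℕ) (k : ℕ) : Tendsto (fun m : ℕ =>
    ((m - (k+1)).factorial : ℝ) * ((m - (l+1)).factorial : ℝ) /
      (((m - 1).factorial : ℝ) * ((m - (k + l + 1)).factorial : ℝ))) atTop (nhds 1) := by
  induction k with
  | zero =>
    apply tendsto_const_nhds.congr
    intro m
    have h1 := Nat.factorial_ne_zero (m - 1)
    have h2 := Nat.factorial_ne_zero (m - (l+1))
    simp only [zero_add]
    field_simp
  | succ k ih =>
    have hq : Tendsto (fun m : ℕ => 1 - (l : ℝ) / ((m - (k + 1) : ℕ) : ℝ)) atTop (nhds 1) := by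
      have h0 : Tendsto (fun m : ℕ => (l : ℝ) / ((m - (k + 1) : ℕ) : ℝ)) atTop (nhds 0) :=
        (tendsto_const_div_atTop_nhds_zero_nat (l : ℝ)).comp (tendsto_sub_atTop_nat (k+1))
      simpa using h0.const_sub 1
    have h := ih.mul hq
    rw [mul_one] at h
    refine h.congr' ?_
    filter_upwards [eventually_ge_atTop (k + l + 3)] with m hm
    obtain ⟨p, rfl⟩ := Nat.exists_eq_add_of_le hm
    have e1 : k + l + 3 + p - (k + 1) = (l + p + 1) + 1 := by omega
    have e2 : k + l + 3 + p - (k + 1 + 1) = l + p + 1 := by omega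
    have e3 : k + l + 3 + p - (k + l + 1) = (p + 1) + 1 := by omega
    have e4 : k + l + 3 + p - (k + 1 + l + 1) = p + 1 := by omega
    rw [e1, e2, e3, e4, Nat.factorial_succ (l + p + 1), Nat.factorial_succ (p + 1)]
    have h1 : ((k + l + 3 + p - 1).factorial : ℝ) ≠ 0 := by exact_mod_cast Nat.factorial_ne_zero _
    have h2 : ((p + 1).factorial : ℝ) ≠ 0 := by exact_mod_cast Nat.factorial_ne_zero _
    have h3 : (l : ℝ) + p + 1 + 1 ≠ 0 := by positivity
    have h4 : (p : ℝ) + 1 + 1 ≠ 0 := by positivity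
    push_cast
    field_simp
    ring

/-- For fixed positive integers `r, r'` with `s = r + r' - 1`, and a sequence `b_n <= n` with
`b_n -> oo` and `b_n/n -> c2` in `[0,1)`, the ratio
`[(b_n-r)!(b_n-r')!n!(n-s)! - b_n!(b_n-s)!(n-r)!(n-r')!] / [(b_n-1)!(b_n-s)!n!(n-s)!]`
converges to `1 - c2`. -/
theorem stmt_17 (r r' : ℕ) (hr : 0 < r) (hr' : 0 < r') (b : ℕ → ℕ) (c₂ : ℝ)
    (hbn : ∀ n, b n ≤ n) (hbtop : Tendsto b atTop atTop)
    (hc : Tendsto (fun n : ℕ => (b n : ℝ) / (n : ℝ)) atTop (nhds c₂))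
    (hc0 : 0 ≤ c₂) (hc1 : c₂ < 1) :
    Tendsto (fun n : ℕ =>
        (((b n - r).factorial : ℝ) * ((b n - r').factorial : ℝ) * (n.factorial : ℝ)
            * ((n - (r + r' - 1)).factorial : ℝ)
          - ((b n).factorial : ℝ) * ((b n - (r + r' - 1)).factorial : ℝ)
            * ((n - r).factorial : ℝ) * ((n - r').factorial : ℝ))
        / (((b n - 1).factorial : ℝ) * ((b n - (r + r' - 1)).factorial : ℝ) * (n.factorial : ℝ)
            * ((n - (r + r' - 1)).factorial : ℝ)))
      atTop (nhds (1 - c₂)) := by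
  obtain ⟨k, rfl⟩ : ∃ k, r = k + 1 := ⟨r - 1, by omega⟩
  obtain ⟨l, rfl⟩ : ∃ l, r' = l + 1 := ⟨r' - 1, by omega⟩
  have es : k + 1 + (l + 1) - 1 = k + l + 1 := by omega
  rw [es]
  have hR := aux_ratio l k
  have h := (hR.comp hbtop).sub (hc.mul hR)
  rw [mul_one] at h
  refine h.congr' ?_
  filter_upwards [eventually_ge_atTop 1, hbtop.eventually_ge_atTop 1] with n hn hb
  simp only [Function.comp]
  have f1 : (n.factorial : ℝ) = n * ((n - 1).factorial : ℝ) := by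
    exact_mod_cast (Nat.mul_factorial_pred (by omega)).symm
  have f2 : ((b n).factorial : ℝ) = b n * ((b n - 1).factorial : ℝ) := by
    exact_mod_cast (Nat.mul_factorial_pred (by omega)).symm
  rw [f1, f2]
  have g (m : ℕ) : (m.factorial : ℝ) ≠ 0 := by exact_mod_cast Nat.factorial_ne_zero _
  have g1 := g (n - 1)
  have g2 := g (b n - 1)
  have g3 := g (n - (k + l + 1))
  have g4 := g (b n - (k + l + 1))
  have g5 : (n : ℝ) ≠ 0 := by positivity
  field_simp
end
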